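/- For every constant C > 0 there exist ε₀ > 0 and N such that the following holds for all integers n ≥ N. Let k be an integer with |k − 2·log₂ n| ≤ C·log log n, let r be an integer with 1 ≤ r ≤ ε₀·(log log n)/(log log log n), and let j ∈ {1, …, r}. If λ := E[Z_{k+1,μ_j}] ≤ n^{1/4}, then |P(Poisson(λ) ≥ ξ_j) − P(Z_{k+1,μ_j} ≥ ξ_j)| ≤ n^{−1/4}. -/

import Mathlib

open scoped Classical

/-- Probability of an event under the uniform measure on simple graphs on `Fin n`
(equivalently, `G_{n,1/2}`). -/
noncomputable def grPr (n : ℕ) (S : Set (SimpleGraph (Fin n))) : ℝ :=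
  ((PMF.uniformOfFintype (SimpleGraph (Fin n))).toOuterMeasure S).toReal

/-- Number of edges of `G` with both endpoints in `s`. -/
noncomputable def edgesIn {n : ℕ} (G : SimpleGraph (Fin n)) (s : Finset (Fin n)) : ℕ :=
  {e ∈ G.edgeSet | ∀ v ∈ e, v ∈ s}.ncard

/-- `Z_{k,i}(G)`: the number of `k`-element vertex subsets inducing exactly `i` edges. -/
noncomputable def numZ (n k i : ℕ) (G : SimpleGraph (Fin n)) : ℕ :=
  (((Finset.univ : Finset (Fin n)).powersetCard k).filter (fun s => edgesIn G s = i)).card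

/-- `E[Z_{k,i}] = C(n,k)·C(C(k,2),i)·2^{-C(k,2)}`. -/
noncomputable def expZ (n k i : ℕ) : ℝ :=
  (n.choose k : ℝ) * ((k.choose 2).choose i : ℝ) / 2 ^ (k.choose 2)

/-- `μ_j = ⌊(r - j)/j⌋`. -/
def muD (r j : ℕ) : ℕ := (r - j) / j

/-- `ξ_j = j(μ_j + 2) - r`. -/
def xiD (r j : ℕ) : ℕ := j * (muD r j + 2) - r

/-- `P(Poisson(λ) ≥ m)`. -/
noncomputable def poissonTail (lam : ℝ) (m : ℕ) : ℝ :=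
  ∑' t : ℕ, if m ≤ t then Real.exp (-lam) * lam ^ t / t.factorial else 0

/-- The Poisson point mass at `t`. -/
noncomputable def poissonMass (lam : ℝ) (t : ℕ) : ℝ :=
  Real.exp (-lam) * lam ^ t / t.factorial

/-- `P(Poisson(λ) < m)`. -/
noncomputable def poissonHead (lam : ℝ) (m : ℕ) : ℝ :=
  ∑ t ∈ Finset.range m, poissonMass lam t

lemma poissonMass_pos {lam : ℝ} (h : 0 < lam) (t : ℕ) : 0 < poissonMass lam t := by
  unfold poissonMass; positivity

lemma succ_mul_poissonMass_succ (lam : ℝ) (t : ℕ) :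
    ((t : ℝ) + 1) * poissonMass lam (t + 1) = lam * poissonMass lam t := by
  unfold poissonMass
  rw [Nat.factorial_succ]
  push_cast
  field_simp
  ring

lemma hasSum_poissonMass (lam : ℝ) : HasSum (poissonMass lam) 1 := by
  have h : HasSum (fun t : ℕ => lam ^ t / t.factorial) (Real.exp lam) := by
    rw [Real.exp_eq_exp_ℝ]
    exact NormedSpace.expSeries_div_hasSum_exp lam
  have h2 := h.mul_left (Real.exp (-lam))
  rw [← Real.exp_add, neg_add_cancel, Real.exp_zero] at h2
  have h3 : poissonMass lam = fun t : ℕ => Real.exp (-lam) * (lam ^ t / t.factorial) := by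
    funext t
    rw [poissonMass, mul_div_assoc]
  rw [h3]
  exact h2

lemma poissonHead_succ (lam : ℝ) (m : ℕ) :
    poissonHead lam (m + 1) = poissonHead lam m + poissonMass lam m :=
  Finset.sum_range_succ _ _

lemma poissonHead_mono {lam : ℝ} (h : 0 < lam) : Monotone (poissonHead lam) :=
  monotone_nat_of_le_succ fun m => by
    rw [poissonHead_succ]; linarith [poissonMass_pos h m]

lemma hasSum_poissonMass_add (lam : ℝ) (m : ℕ) :
    HasSum (fun t => poissonMass lam (t + m)) (1 - poissonHead lam m) :=
  (hasSum_nat_add_iff' m).2 (hasSum_poissonMass lam)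

lemma poissonHead_le_one {lam : ℝ} (h : 0 < lam) (m : ℕ) : poissonHead lam m ≤ 1 := by
  have := (hasSum_poissonMass_add lam m).nonneg fun t => (poissonMass_pos h _).le
  linarith

lemma poissonHead_nonneg {lam : ℝ} (h : 0 < lam) (m : ℕ) : 0 ≤ poissonHead lam m :=
  Finset.sum_nonneg fun t _ => (poissonMass_pos h t).le

lemma poissonTail_eq (lam : ℝ) (m : ℕ) : poissonTail lam m = 1 - poissonHead lam m := by
  have h : HasSum (fun t : ℕ => if m ≤ t then poissonMass lam t else 0)
      (1 - poissonHead lam m) := by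
    rw [← hasSum_nat_add_iff' m]
    have h0 : ∑ t ∈ Finset.range m, (if m ≤ t then poissonMass lam t else 0) = 0 :=
      Finset.sum_eq_zero fun t ht => if_neg (by simpa using ht)
    rw [h0, sub_zero]
    simpa using hasSum_poissonMass_add lam m
  exact h.tsum_eq

lemma sub_mul_poissonHead_le {lam : ℝ} (h : 0 < lam) (w : ℕ) :
    (lam - w) * poissonHead lam (w + 1) ≤ lam * poissonMass lam w := by
  induction w with
  | zero => simp [poissonHead]
  | succ w ih =>
    rw [← succ_mul_poissonMass_succ] at ih
    rw [poissonHead_succ lam (w + 1)]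
    push_cast
    nlinarith [poissonHead_nonneg h (w + 1)]

lemma succ_sub_mul_poissonTail_le {lam : ℝ} (h : 0 < lam) (w : ℕ) :
    ((w : ℝ) + 1 - lam) * (1 - poissonHead lam (w + 1)) ≤ lam * poissonMass lam w := by
  have key : ((w : ℝ) + 1) * (1 - poissonHead lam (w + 2)) ≤
      lam * (1 - poissonHead lam (w + 1)) := by
    refine hasSum_le (fun t => ?_) ((hasSum_poissonMass_add lam (w + 2)).mul_left _)
      ((hasSum_poissonMass_add lam (w + 1)).mul_left _)
    have := succ_mul_poissonMass_succ lam (t + (w + 1))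
    rw [← this]
    refine mul_le_mul_of_nonneg_right ?_ (poissonMass_pos h _).le
    push_cast
    have : (0 : ℝ) ≤ t := t.cast_nonneg
    linarith
  rw [poissonHead_succ lam (w + 1)] at key
  rw [← succ_mul_poissonMass_succ]
  linarith

lemma poissonHead_mul_poissonTail_le {lam : ℝ} (h : 0 < lam) (w : ℕ) :
    poissonHead lam (w + 1) * (1 - poissonHead lam (w + 1)) ≤ 2 * (lam * poissonMass lam w) := by
  have hB0 := poissonHead_nonneg h (w + 1)
  have hB1 := poissonHead_le_one h (w + 1)
  have hp := mul_pos h (poissonMass_pos h w)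
  rcases le_total ((w : ℝ) + 1) lam with hw | hw
  · have := sub_mul_poissonHead_le h w
    nlinarith
  · have h1 := succ_sub_mul_poissonTail_le h (w + 1)
    have h2 := succ_mul_poissonMass_succ lam w
    have h3 := poissonHead_succ lam (w + 1)
    have hB2 := poissonHead_le_one h (w + 2)
    have hp1 := poissonMass_pos h (w + 1)
    push_cast at h1
    have h4 : 1 - poissonHead lam (w + 2) ≤ lam * poissonMass lam (w + 1) := by
      nlinarith
    have h5 : 1 - poissonHead lam (w + 1) ≤ 2 * (lam * poissonMass lam w) := by
      have hw0 : (0 : ℝ) ≤ w := w.cast_nonneg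
      rw [← h2]
      nlinarith
    nlinarith

/-- The Stein equation for Poisson tails has a solution of oscillation at most `2`. -/
lemma exists_poisson_stein_solution {lam : ℝ} (h : 0 < lam) (m : ℕ) :
    ∃ g : ℕ → ℝ, (∀ a b, |g a - g b| ≤ 2) ∧
      ∀ w : ℕ, lam * g (w + 1) - w * g w = (if m ≤ w then 1 else 0) - poissonTail lam m := by
  set B := poissonHead lam with hB
  set p := poissonMass lam with hp
  have hpos : ∀ w, 0 < p w := poissonMass_pos h
  have hrec : ∀ w : ℕ, lam * p w = ((w : ℝ) + 1) * p (w + 1) := fun w =>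
    (succ_mul_poissonMass_succ lam w).symm
  have hsucc : ∀ w, B (w + 1) = B w + p w := poissonHead_succ lam
  have hzero : B 0 = 0 := by simp [hB, poissonHead]
  let G : ℕ → ℝ := fun w =>
    if w < m then -((1 - B m) * B (w + 1)) / (lam * p w)
    else -(B m * (1 - B (w + 1))) / (lam * p w)
  let g : ℕ → ℝ := fun w => Nat.casesOn w 0 G
  have hG : ∀ w, -2 ≤ G w ∧ G w ≤ 0 := by
    intro w
    have hq : 0 < lam * p w := mul_pos h (hpos w)
    have hb := poissonHead_mul_poissonTail_le h w
    have h0 := poissonHead_nonneg h (w + 1)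
    have h1 := poissonHead_le_one h (w + 1)
    have h0' := poissonHead_nonneg h m
    have h1' := poissonHead_le_one h m
    by_cases hw : w < m
    · have hm : B (w + 1) ≤ B m := poissonHead_mono h hw
      simp only [G, if_pos hw]
      rw [le_div_iff₀ hq, div_le_iff₀ hq]
      constructor <;> nlinarith
    · have hm : B m ≤ B (w + 1) := poissonHead_mono h (by omega)
      simp only [G, if_neg hw]
      rw [le_div_iff₀ hq, div_le_iff₀ hq]
      constructor <;> nlinarith
  have hg : ∀ w, -2 ≤ g w ∧ g w ≤ 0 := by
    intro w
    cases w with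
    | zero => simp [g]
    | succ w => exact hG w
  refine ⟨g, fun a b => ?_, fun w => ?_⟩
  · rw [abs_le]
    constructor <;> linarith [(hg a).1, (hg a).2, (hg b).1, (hg b).2]
  · rw [poissonTail_eq]
    change lam * G w - w * g w = _ - (1 - B m)
    cases w with
    | zero =>
      have h1 : B 1 = p 0 := by rw [hsucc, hzero, zero_add]
      have hp0 := (hpos 0).ne'
      rcases Nat.eq_zero_or_pos m with rfl | hm
      · simp [G, hzero]
      · simp only [G, if_pos hm, if_neg hm.not_ge, zero_add, h1]
        push_cast
        field_simp
        ring
    | succ w =>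
      have hp1 := (hpos (w + 1)).ne'
      have hw1 : (w : ℝ) + 1 ≠ 0 := by positivity
      change lam * G (w + 1) - ((w + 1 : ℕ) : ℝ) * G w = _
      simp only [G]
      rw [hrec w, hsucc (w + 1)]
      push_cast
      rcases lt_trichotomy (w + 1) m with hm | hm | hm
      · rw [if_pos hm, if_pos (by omega), if_neg (by omega)]
        field_simp
        ring
      · rw [if_neg (by omega), if_pos (by omega), if_pos (by omega), ← hm]
        field_simp
        ring
      · rw [if_neg (by omega), if_neg (by omega), if_pos (by omega)]
        field_simp
        ring
open scoped BigOperators in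
/-- Chen–Stein bound for the upper tails of a sum of locally dependent indicators on a finite
uniform probability space. -/
theorem abs_poissonTail_sub_expect_le {ι Ω : Type*} [DecidableEq ι] [Fintype Ω] [Nonempty Ω]
    (I : Finset ι) (X : ι → Ω → Prop) [∀ a ω, Decidable (X a ω)] (N : ι → Finset ι)
    (hNI : ∀ a ∈ I, N a ⊆ I) (hself : ∀ a ∈ I, a ∈ N a)
    (hind : ∀ a ∈ I, ∀ φ : ℕ → ℝ,
      (𝔼 ω, (if X a ω then (1 : ℝ) else 0) * φ ((I \ N a).filter (X · ω)).card) =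
        (𝔼 ω, (if X a ω then (1 : ℝ) else 0)) * 𝔼 ω, φ ((I \ N a).filter (X · ω)).card)
    {lam : ℝ} (hpos : 0 < lam) (hlam : ∑ a ∈ I, (𝔼 ω, (if X a ω then (1 : ℝ) else 0)) = lam)
    (m : ℕ) :
    |poissonTail lam m - 𝔼 ω, (if m ≤ (I.filter (X · ω)).card then (1 : ℝ) else 0)| ≤
      2 * ∑ a ∈ I, (∑ b ∈ N a, (𝔼 ω, (if X a ω then (1 : ℝ) else 0)) *
          (𝔼 ω, (if X b ω then (1 : ℝ) else 0)) +
        ∑ b ∈ (N a).erase a, 𝔼 ω, (if X a ω then (1 : ℝ) else 0) *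
          (if X b ω then (1 : ℝ) else 0)) := by
  obtain ⟨g, hg, hstein⟩ := exists_poisson_stein_solution hpos m
  set x : ι → Ω → ℝ := fun a ω => if X a ω then 1 else 0 with hx
  set W : Ω → ℕ := fun ω => (I.filter (X · ω)).card with hW
  set V : ι → Ω → ℕ := fun a ω => ((I \ N a).filter (X · ω)).card with hV
  have hx0 : ∀ a ω, 0 ≤ x a ω := fun a ω => by simp only [hx]; split_ifs <;> norm_num
  have hcard : ∀ (J : Finset ι) ω, ((J.filter (X · ω)).card : ℝ) = ∑ a ∈ J, x a ω := by
    intro J ω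
    simp [hx, Finset.sum_boole]
  have hsplit : ∀ a ∈ I, ∀ ω, W ω = V a ω + ((N a).filter (X · ω)).card := by
    intro a ha ω
    simp only [hW, hV]
    rw [← Finset.card_union_of_disjoint
      ((Finset.sdiff_disjoint).mono (Finset.filter_subset _ _) (Finset.filter_subset _ _)),
      ← Finset.filter_union, Finset.sdiff_union_of_subset (hNI a ha)]
  have h1 : ∀ a ∈ I, ∀ ω, |g (W ω + 1) - g (V a ω + 1)| ≤ 2 * ∑ b ∈ N a, x b ω := by
    intro a ha ω
    rw [hsplit a ha ω, ← hcard]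
    rcases Nat.eq_zero_or_pos ((N a).filter (X · ω)).card with h | h
    · simp [h]
    · have : (1 : ℝ) ≤ ((N a).filter (X · ω)).card := by exact_mod_cast h
      exact (hg _ _).trans (by linarith)
  have h2 : ∀ a ∈ I, ∀ ω, |x a ω * (g (V a ω + 1) - g (W ω))| ≤
      2 * ∑ b ∈ (N a).erase a, x a ω * x b ω := by
    intro a ha ω
    by_cases hX : X a ω
    · have hxa : x a ω = 1 := if_pos hX
      have hNe : ((N a).filter (X · ω)).card = (((N a).erase a).filter (X · ω)).card + 1 := by
        rw [Finset.filter_erase, Finset.card_erase_add_one]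
        exact Finset.mem_filter.2 ⟨hself a ha, hX⟩
      simp only [hxa, one_mul]
      rw [hsplit a ha ω, hNe, ← hcard]
      rcases Nat.eq_zero_or_pos (((N a).erase a).filter (X · ω)).card with h | h
      · simp [h]
      · have : (1 : ℝ) ≤ (((N a).erase a).filter (X · ω)).card := by exact_mod_cast h
        exact (hg _ _).trans (by linarith)
    · have hxa : x a ω = 0 := if_neg hX
      simp [hxa]
  have key : (𝔼 ω, (if m ≤ W ω then (1 : ℝ) else 0)) - poissonTail lam m =
      ∑ a ∈ I, ((𝔼 ω, x a ω) * (𝔼 ω, (g (W ω + 1) - g (V a ω + 1))) +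
        𝔼 ω, x a ω * (g (V a ω + 1) - g (W ω))) := by
    have e1 : (𝔼 ω, (if m ≤ W ω then (1 : ℝ) else 0)) - poissonTail lam m =
        𝔼 ω, (lam * g (W ω + 1) - ∑ a ∈ I, x a ω * g (W ω)) := by
      rw [← Fintype.expect_const (ι := Ω) (poissonTail lam m), ← Finset.expect_sub_distrib]
      refine Finset.expect_congr rfl fun ω _ => ?_
      rw [← hstein (W ω), ← Finset.sum_mul, ← hcard]
    rw [e1, Finset.expect_sub_distrib, Finset.expect_sum_comm, ← Finset.mul_expect, ← hlam,
      Finset.sum_mul, ← Finset.sum_sub_distrib]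
    refine Finset.sum_congr rfl fun a ha => ?_
    have := hind a ha (fun v => g (v + 1))
    simp only [mul_sub, Finset.expect_sub_distrib]
    linarith
  rw [abs_sub_comm, key, Finset.mul_sum]
  refine (Finset.abs_sum_le_sum_abs _ _).trans (Finset.sum_le_sum fun a ha => ?_)
  have hp : 0 ≤ 𝔼 ω, x a ω := Finset.expect_nonneg fun ω _ => hx0 a ω
  have b1 : |𝔼 ω, (g (W ω + 1) - g (V a ω + 1))| ≤ 2 * ∑ b ∈ N a, 𝔼 ω, x b ω := by
    rw [← Finset.expect_sum_comm, Finset.mul_expect]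
    exact (Finset.abs_expect_le _ _).trans (Finset.expect_le_expect fun ω _ => h1 a ha ω)
  have b2 : |𝔼 ω, x a ω * (g (V a ω + 1) - g (W ω))| ≤
      2 * ∑ b ∈ (N a).erase a, 𝔼 ω, x a ω * x b ω := by
    rw [← Finset.expect_sum_comm, Finset.mul_expect]
    exact (Finset.abs_expect_le _ _).trans (Finset.expect_le_expect fun ω _ => h2 a ha ω)
  refine (abs_add_le _ _).trans ?_
  rw [abs_mul, abs_of_nonneg hp, mul_add, ← Finset.mul_sum]
  have := mul_le_mul_of_nonneg_left b1 hp
  linarith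

open scoped BigOperators in
lemma expect_inter_mul_sdiff {ε : Type*} [Fintype ε] [DecidableEq ε] (D : Finset ε) (f h : Finset ε → ℝ) :
    (𝔼 T : Finset ε, f (T ∩ D) * h (T \ D)) =
      (𝔼 T : Finset ε, f (T ∩ D)) * 𝔼 T : Finset ε, h (T \ D) := by
  let F : Finset ε × Finset ε → Finset ε × Finset ε := fun p =>
    ((p.1 ∩ D) ∪ (p.2 \ D), (p.2 ∩ D) ∪ (p.1 \ D))
  have hF : Function.Involutive F := by
    rintro ⟨S, T⟩
    ext e <;> by_cases he : e ∈ D <;> simp [F, he]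
  rw [Finset.expect_mul_expect, ← Finset.expect_product', Finset.univ_product_univ]
  rw [Fintype.expect_equiv hF.toPerm (fun p : Finset ε × Finset ε => f (p.1 ∩ D) * h (p.2 \ D))
    (fun p => f (p.1 ∩ D) * h (p.1 \ D))]
  · rw [← Finset.univ_product_univ,
      Finset.expect_product' (f := fun (S : Finset ε) (_ : Finset ε) => f (S ∩ D) * h (S \ D))]
    simp
  · rintro ⟨S, T⟩
    have e1 : (F (S, T)).1 ∩ D = S ∩ D := by
      ext e; by_cases he : e ∈ D <;> simp [F, he]
    have e2 : (F (S, T)).1 \ D = T \ D := by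
      ext e; by_cases he : e ∈ D <;> simp [F, he]
    change _ = f ((F (S, T)).1 ∩ D) * h ((F (S, T)).1 \ D)
    rw [e1, e2]

open scoped BigOperators in
/-- The number of elements of `D` in a uniformly random subset is binomial. -/
lemma expect_card_inter_eq {ε : Type*} [Fintype ε] [DecidableEq ε] (D : Finset ε) (i : ℕ) :
    (𝔼 T : Finset ε, if (T ∩ D).card = i then (1 : ℝ) else 0) =
      (D.card.choose i : ℝ) / 2 ^ D.card := by
  have hcard : ((Finset.univ : Finset (Finset ε)).filter (fun T => (T ∩ D).card = i)).card =
      D.card.choose i * 2 ^ Dᶜ.card := by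
    rw [← Finset.card_powersetCard, ← Finset.card_powerset, ← Finset.card_product]
    refine Finset.card_nbij' (fun T => (T ∩ D, T \ D)) (fun p => p.1 ∪ p.2) ?_ ?_ ?_ ?_
    · intro T hT
      simp only [Finset.coe_filter, Finset.mem_univ, true_and, Set.mem_ofPred_eq] at hT
      simp only [Finset.coe_product, Set.mem_prod, Finset.mem_coe, Finset.mem_powersetCard,
        Finset.mem_powerset]
      exact ⟨⟨Finset.inter_subset_right, hT⟩, by intro e; simp⟩
    · rintro ⟨S, T⟩ hp
      simp only [Finset.coe_product, Set.mem_prod, Finset.mem_coe, Finset.mem_powersetCard,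
        Finset.mem_powerset] at hp
      obtain ⟨⟨hS, hi⟩, hT⟩ := hp
      have : (S ∪ T) ∩ D = S := by
        ext e
        have h1 := @hS e
        have h2 := @hT e
        simp only [Finset.mem_compl] at h2
        simp only [Finset.mem_inter, Finset.mem_union]
        tauto
      simp [this, hi]
    · intro T _
      ext e; by_cases he : e ∈ D <;> simp [he]
    · rintro ⟨S, T⟩ hp
      simp only [Finset.coe_product, Set.mem_prod, Finset.mem_coe, Finset.mem_powersetCard,
        Finset.mem_powerset] at hp
      obtain ⟨⟨hS, hi⟩, hT⟩ := hp
      have h2 : ∀ e ∈ T, e ∉ D := fun e he => by simpa using hT he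
      ext e
      · have h1 := @hS e
        have h2 := h2 e
        simp only [Finset.mem_inter, Finset.mem_union]
        tauto
      · have h1 := @hS e
        have h2 := h2 e
        simp only [Finset.mem_sdiff, Finset.mem_union]
        tauto
  rw [Fintype.expect_eq_sum_div_card, Finset.sum_boole, hcard, Fintype.card_finset,
    ← Finset.card_add_card_compl D, pow_add]
  push_cast
  field_simp

open scoped BigOperators in
lemma expect_card_inter_le {ε : Type*} [Fintype ε] [DecidableEq ε] (D : Finset ε) (i : ℕ) :
    (𝔼 T : Finset ε, if (T ∩ D).card ≤ i then (1 : ℝ) else 0) ≤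
      ((D.card : ℝ) + 1) ^ i / 2 ^ D.card := by
  have h : ∀ T : Finset ε, (if (T ∩ D).card ≤ i then (1 : ℝ) else 0) =
      ∑ t ∈ Finset.range (i + 1), if (T ∩ D).card = t then (1 : ℝ) else 0 := by
    intro T
    simp [Finset.sum_ite_eq]
  simp only [h]
  rw [Finset.expect_sum_comm]
  simp only [expect_card_inter_eq]
  rw [← Finset.sum_div]
  gcongr
  rw [add_pow]
  refine Finset.sum_le_sum fun t ht => ?_
  have h1 : (D.card.choose t : ℝ) ≤ (D.card : ℝ) ^ t := by exact_mod_cast Nat.choose_le_pow _ _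
  have h2 : (1 : ℝ) ≤ i.choose t := by
    exact_mod_cast Nat.choose_pos (by simpa [Nat.lt_succ_iff] using ht)
  rw [one_pow, mul_one]
  exact h1.trans (le_mul_of_one_le_right (by positivity) h2)
/-- Potential edges of a graph on `Fin n`. -/
abbrev EdgeSlot (n : ℕ) : Type := {e : Sym2 (Fin n) // ¬e.IsDiag}

/-- Potential edges with both endpoints in `A`. -/
noncomputable def slotsIn {n : ℕ} (A : Finset (Fin n)) : Finset (EdgeSlot n) :=
  Finset.univ.filter fun e => ∀ v ∈ e.1, v ∈ A

lemma slotsIn_inter {n : ℕ} (A B : Finset (Fin n)) :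
    slotsIn A ∩ slotsIn B = slotsIn (A ∩ B) := by
  ext e
  simp only [slotsIn, Finset.mem_inter, Finset.mem_filter, Finset.mem_univ, true_and]
  exact forall₂_and.symm

lemma card_slotsIn {n : ℕ} (A : Finset (Fin n)) : (slotsIn A).card = A.card.choose 2 := by
  rw [← Sym2.card_image_offDiag, ← Finset.card_map (Function.Embedding.subtype _)]
  congr 1
  ext e
  induction e using Sym2.ind with
  | _ x y =>
    simp only [slotsIn, Finset.mem_map, Finset.mem_filter, Finset.mem_univ, true_and,
      Function.Embedding.subtype_apply, Subtype.exists, exists_and_left, exists_prop,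
      exists_eq_right_right, Finset.mem_image, Finset.mem_offDiag, Prod.exists, Sym2.mem_iff,
      Sym2.mk_isDiag_iff]
    constructor
    · rintro ⟨h1, h2⟩
      exact ⟨x, y, ⟨h1 x (.inl rfl), h1 y (.inr rfl), h2⟩, rfl⟩
    · rintro ⟨a, b, ⟨ha, hb, hab⟩, h⟩
      rcases Sym2.eq_iff.1 h with ⟨rfl, rfl⟩ | ⟨rfl, rfl⟩
      · refine ⟨?_, hab⟩
        rintro v (rfl | rfl) <;> assumption
      · refine ⟨?_, Ne.symm hab⟩
        rintro v (rfl | rfl) <;> assumption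

/-- A simple graph is the same as a set of potential edges. -/
noncomputable def graphEquivSlots (n : ℕ) : SimpleGraph (Fin n) ≃ Finset (EdgeSlot n) where
  toFun G := Finset.univ.filter fun e => e.1 ∈ G.edgeSet
  invFun T := SimpleGraph.fromEdgeSet (((↑) : EdgeSlot n → Sym2 (Fin n)) '' (T : Set (EdgeSlot n)))
  left_inv G := by
    ext x y
    simp only [SimpleGraph.fromEdgeSet_adj, Set.mem_image, Finset.mem_coe, Finset.mem_filter,
      Finset.mem_univ, true_and, Subtype.exists, exists_and_left, exists_prop]
    constructor
    · rintro ⟨⟨e, h1, h2, rfl⟩, h3⟩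
      exact h1
    · intro h
      exact ⟨⟨s(x, y), h, by simpa using h.ne, rfl⟩, h.ne⟩
  right_inv T := by
    ext e
    simp only [Finset.mem_filter, Finset.mem_univ, true_and, SimpleGraph.edgeSet_fromEdgeSet,
      Set.mem_sdiff, Set.mem_image, Finset.mem_coe]
    constructor
    · rintro ⟨⟨e', h, h'⟩, -⟩
      rwa [← Subtype.ext h']
    · intro h
      exact ⟨⟨e, h, rfl⟩, by simpa using e.2⟩

lemma edgesIn_eq {n : ℕ} (G : SimpleGraph (Fin n)) (A : Finset (Fin n)) :
    edgesIn G A = (graphEquivSlots n G ∩ slotsIn A).card := by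
  rw [edgesIn, ← Finset.card_map (Function.Embedding.subtype _), ← Set.ncard_coe_finset]
  congr 1
  ext e
  simp only [graphEquivSlots, slotsIn, Equiv.coe_fn_mk, Set.mem_ofPred_eq, Finset.coe_map,
    Set.mem_image, Finset.mem_coe, Finset.mem_inter, Finset.mem_filter, Finset.mem_univ, true_and,
    Function.Embedding.subtype_apply, Subtype.exists, exists_and_left, exists_prop,
      exists_eq_right_right]
  constructor
  · rintro ⟨h1, h2⟩
    exact ⟨⟨h1, h2⟩, G.not_isDiag_of_mem_edgeSet h1⟩
  · rintro ⟨h, -⟩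
    exact h

open scoped BigOperators in
lemma grPr_eq_expect (n : ℕ) (S : Set (SimpleGraph (Fin n))) :
    grPr n S = 𝔼 T : Finset (EdgeSlot n),
      if (graphEquivSlots n).symm T ∈ S then (1 : ℝ) else 0 := by
  rw [← Fintype.expect_equiv (graphEquivSlots n) (fun G => if G ∈ S then (1 : ℝ) else 0) _
    (fun G => by simp)]
  rw [grPr, PMF.toOuterMeasure_uniformOfFintype_apply, Fintype.expect_eq_sum_div_card,
    Finset.sum_boole, ENNReal.toReal_div, ← Fintype.card_subtype]
  simp

open scoped BigOperators in
lemma grPr_numZ_eq (n K i m : ℕ) :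
    grPr n {G | m ≤ numZ n K i G} = 𝔼 T : Finset (EdgeSlot n),
      if m ≤ (((Finset.univ : Finset (Fin n)).powersetCard K).filter
        (fun A => (T ∩ slotsIn A).card = i)).card then (1 : ℝ) else 0 := by
  rw [grPr_eq_expect]
  refine Finset.expect_congr rfl fun T _ => ?_
  simp only [numZ, edgesIn_eq, Set.mem_ofPred_eq, Equiv.apply_symm_apply]

/-- At most `C(K,s) C(n,K-s)` sets of size `K` meet a given set of size `K` in `s` points. -/
lemma card_filter_card_inter_le {n K : ℕ} (A : Finset (Fin n)) (hA : A.card = K) (s : ℕ) :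
    (((Finset.univ : Finset (Fin n)).powersetCard K).filter (fun B => (A ∩ B).card = s)).card ≤
      K.choose s * n.choose (K - s) := by
  have : K.choose s * n.choose (K - s) =
      (A.powersetCard s ×ˢ (Finset.univ : Finset (Fin n)).powersetCard (K - s)).card := by
    simp [hA]
  rw [this]
  refine Finset.card_le_card_of_injOn (fun B => (A ∩ B, B \ A)) ?_ ?_
  · intro B hB
    simp only [Finset.coe_filter, Finset.mem_powersetCard, Finset.subset_univ, true_and,
      Set.mem_ofPred_eq] at hB
    simp only [Finset.coe_product, Set.mem_prod, Finset.mem_coe, Finset.mem_powersetCard,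
      Finset.subset_univ, true_and]
    refine ⟨⟨Finset.inter_subset_left, hB.2⟩, ?_⟩
    rw [Finset.card_sdiff, hB.1, hB.2]
  · intro B _ B' _ h
    simp only [Prod.mk.injEq] at h
    rw [← Finset.sdiff_union_inter B A, ← Finset.sdiff_union_inter B' A, Finset.inter_comm B,
      Finset.inter_comm B', h.1, h.2]

/-- An explicit Poisson approximation bound for the upper tails of `Z_{K,i}`. -/
theorem abs_poissonTail_sub_grPr_le {n K i : ℕ} (hK : 2 ≤ K) (hpos : 0 < expZ n K i) (m : ℕ) :
    |poissonTail (expZ n K i) m - grPr n {G | m ≤ numZ n K i G}| ≤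
      2 * expZ n K i * (((K.choose 2).choose i : ℝ) / 2 ^ (K.choose 2) +
        2 * ∑ s ∈ Finset.Ico 2 K, (K.choose s * n.choose (K - s) : ℝ) *
          (((K : ℝ) ^ 2) ^ i / 2 ^ (K.choose 2 - s.choose 2))) := by
  set I := (Finset.univ : Finset (Fin n)).powersetCard K with hI
  set p : ℝ := ((K.choose 2).choose i : ℝ) / 2 ^ (K.choose 2) with hp
  have hp0 : 0 ≤ p := by positivity
  let N : Finset (Fin n) → Finset (Finset (Fin n)) := fun A => I.filter fun B => 2 ≤ (A ∩ B).card
  let H : ℕ → ℝ := fun s => ((K : ℝ) ^ 2) ^ i / 2 ^ (K.choose 2 - s.choose 2)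
  have hIc : ∀ A ∈ I, A.card = K := fun A hA => (Finset.mem_powersetCard.1 hA).2
  have hprob : ∀ A ∈ I, (Finset.univ.expect fun T : Finset (EdgeSlot n) =>
      if (T ∩ slotsIn A).card = i then (1 : ℝ) else 0) = p := by
    intro A hA
    rw [expect_card_inter_eq, card_slotsIn, hIc A hA]
  have hsum : ∑ A ∈ I, (Finset.univ.expect fun T : Finset (EdgeSlot n) =>
      if (T ∩ slotsIn A).card = i then (1 : ℝ) else 0) = expZ n K i := by
    rw [Finset.sum_congr rfl hprob]
    simp [hI, hp, expZ, mul_div_assoc]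
  have hout : ∀ A ∈ I, ∀ B ∈ I, (Finset.univ.expect fun T : Finset (EdgeSlot n) =>
      if (T ∩ (slotsIn B \ slotsIn A)).card ≤ i then (1 : ℝ) else 0) ≤ H (A ∩ B).card := by
    intro A hA B hB
    refine (expect_card_inter_le _ _).trans ?_
    have hc : (slotsIn B \ slotsIn A).card = K.choose 2 - (A ∩ B).card.choose 2 := by
      rw [Finset.card_sdiff, slotsIn_inter, card_slotsIn, card_slotsIn, hIc B hB]
    rw [hc]
    simp only [H]
    gcongr
    have : K.choose 2 + 1 ≤ K ^ 2 := by
      rw [Nat.choose_two_right]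
      obtain ⟨k, rfl⟩ : ∃ k, K = k + 1 := ⟨K - 1, by omega⟩
      have h1 : (k + 1) * (k + 1 - 1) / 2 ≤ (k + 1) * (k + 1 - 1) := Nat.div_le_self _ _
      simp only [Nat.add_sub_cancel] at h1 ⊢
      nlinarith
    have h2 : ((K.choose 2 - (A ∩ B).card.choose 2 : ℕ) : ℝ) ≤ (K.choose 2 : ℕ) := by
      exact_mod_cast Nat.sub_le _ _
    have h3 : ((K.choose 2 : ℕ) : ℝ) + 1 ≤ (K : ℝ) ^ 2 := by exact_mod_cast this
    linarith
  have himp : ∀ A B : Finset (Fin n), ∀ T : Finset (EdgeSlot n),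
      (if (T ∩ slotsIn B).card = i then (1 : ℝ) else 0) ≤
        if (T ∩ (slotsIn B \ slotsIn A)).card ≤ i then (1 : ℝ) else 0 := by
    intro A B T
    by_cases h : (T ∩ slotsIn B).card = i
    · have : (T ∩ (slotsIn B \ slotsIn A)).card ≤ i :=
        h ▸ Finset.card_le_card (Finset.inter_subset_inter_left Finset.sdiff_subset)
      simp [h, this]
    · rw [if_neg h]; split_ifs <;> norm_num
  have hind : ∀ A ∈ I, ∀ φ : ℕ → ℝ,
      (Finset.univ.expect fun T : Finset (EdgeSlot n) =>
        (if (T ∩ slotsIn A).card = i then (1 : ℝ) else 0) *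
          φ ((I \ N A).filter (fun B => (T ∩ slotsIn B).card = i)).card) =
      (Finset.univ.expect fun T : Finset (EdgeSlot n) =>
        if (T ∩ slotsIn A).card = i then (1 : ℝ) else 0) *
      (Finset.univ.expect fun T : Finset (EdgeSlot n) =>
          φ ((I \ N A).filter (fun B => (T ∩ slotsIn B).card = i)).card) := by
    intro A hA φ
    have hfil : ∀ T : Finset (EdgeSlot n),
        (I \ N A).filter (fun B => (T ∩ slotsIn B).card = i) =
        (I \ N A).filter (fun B => ((T \ slotsIn A) ∩ slotsIn B).card = i) := by
      intro T
      refine Finset.filter_congr fun B hB => ?_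
      have hs : (A ∩ B).card < 2 := by
        simp only [N, Finset.mem_sdiff, Finset.mem_filter, not_and, not_le] at hB
        exact hB.2 hB.1
      have he : slotsIn A ∩ slotsIn B = ∅ := by
        rw [slotsIn_inter, ← Finset.card_eq_zero, card_slotsIn, Nat.choose_eq_zero_of_lt hs]
      have : T ∩ slotsIn B = (T \ slotsIn A) ∩ slotsIn B := by
        ext e
        have := Finset.ext_iff.1 he e
        simp only [Finset.mem_inter, Finset.notMem_empty, iff_false] at this
        simp only [Finset.mem_inter, Finset.mem_sdiff]
        tauto
      rw [this]
    have hfactor := expect_inter_mul_sdiff (slotsIn A)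
      (fun S => if S.card = i then (1 : ℝ) else 0)
      (fun S => φ ((I \ N A).filter (fun B => (S ∩ slotsIn B).card = i)).card)
    simpa only [← hfil] using hfactor
  have hself : ∀ A ∈ I, A ∈ N A := by
    intro A hA
    simpa only [N, Finset.mem_filter, Finset.inter_self, hIc A hA] using ⟨hA, hK⟩
  have main := abs_poissonTail_sub_expect_le I
    (fun A (T : Finset (EdgeSlot n)) => (T ∩ slotsIn A).card = i) N
    (fun A _ => Finset.filter_subset _ _) hself hind hpos hsum m
  rw [grPr_numZ_eq]
  refine main.trans ?_
  set S : ℝ := ∑ s ∈ Finset.Ico 2 K, (K.choose s * n.choose (K - s) : ℝ) * H s with hS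
  have hH0 : ∀ s, 0 ≤ H s := fun s => by simp only [H]; positivity
  have hfib : ∀ A ∈ I, ∑ B ∈ (N A).erase A, H (A ∩ B).card ≤ S := by
    intro A hA
    rw [← Finset.sum_fiberwise_of_maps_to (t := Finset.Ico 2 K) (g := fun B => (A ∩ B).card)]
    · refine Finset.sum_le_sum fun s _ => ?_
      have hle : (((N A).erase A).filter (fun B => (A ∩ B).card = s)).card ≤
          K.choose s * n.choose (K - s) := by
        refine le_trans (Finset.card_le_card ?_) (card_filter_card_inter_le A (hIc A hA) s)
        exact Finset.filter_subset_filter _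
          ((Finset.erase_subset _ _).trans (Finset.filter_subset _ _))
      rw [Finset.sum_congr rfl (g := fun _ => H s)
        (fun B hB => by rw [(Finset.mem_filter.1 hB).2]), Finset.sum_const, nsmul_eq_mul]
      exact mul_le_mul_of_nonneg_right (by exact_mod_cast hle) (hH0 s)
    · intro B hB
      simp only [N, Finset.mem_erase, Finset.mem_filter] at hB
      obtain ⟨hne, hBI, h2⟩ := hB
      refine Finset.mem_Ico.2 ⟨h2, ?_⟩
      by_contra! hcon
      have e1 : A ∩ B = A := Finset.eq_of_subset_of_card_le Finset.inter_subset_left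
        (by rw [hIc A hA]; exact hcon)
      have e2 : A ∩ B = B := Finset.eq_of_subset_of_card_le Finset.inter_subset_right
        (by rw [hIc B hBI]; exact hcon)
      exact hne (e2.symm.trans e1)
  have hNI : ∀ A, ∀ B ∈ (N A).erase A, B ∈ I := fun A B hB =>
    (Finset.mem_filter.1 (Finset.mem_of_mem_erase hB)).1
  have hterm : ∀ A ∈ I, (∑ B ∈ N A,
      (Finset.univ.expect fun T : Finset (EdgeSlot n) =>
        if (T ∩ slotsIn A).card = i then (1 : ℝ) else 0) *
      (Finset.univ.expect fun T : Finset (EdgeSlot n) =>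
        if (T ∩ slotsIn B).card = i then (1 : ℝ) else 0)) +
      ∑ B ∈ (N A).erase A, (Finset.univ.expect fun T : Finset (EdgeSlot n) =>
        (if (T ∩ slotsIn A).card = i then (1 : ℝ) else 0) *
        (if (T ∩ slotsIn B).card = i then (1 : ℝ) else 0)) ≤ p * (p + 2 * S) := by
    intro A hA
    have t1 : ∑ B ∈ (N A).erase A, (Finset.univ.expect fun T : Finset (EdgeSlot n) =>
        if (T ∩ slotsIn B).card = i then (1 : ℝ) else 0) ≤ S := by
      refine (Finset.sum_le_sum fun B hB => ?_).trans (hfib A hA)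
      exact (Finset.expect_le_expect fun T _ => himp A B T).trans (hout A hA B (hNI A B hB))
    have t2 : ∑ B ∈ (N A).erase A, (Finset.univ.expect fun T : Finset (EdgeSlot n) =>
        (if (T ∩ slotsIn A).card = i then (1 : ℝ) else 0) *
        (if (T ∩ slotsIn B).card = i then (1 : ℝ) else 0)) ≤ p * S := by
      refine le_trans (Finset.sum_le_sum fun B hB => ?_)
        ((Finset.mul_sum _ _ _).symm.le.trans (mul_le_mul_of_nonneg_left (hfib A hA) hp0))
      refine (Finset.expect_le_expect fun T _ => mul_le_mul_of_nonneg_left (himp A B T)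
        (by split_ifs <;> norm_num)).trans ?_
      have hfac : ∀ T : Finset (EdgeSlot n), T ∩ (slotsIn B \ slotsIn A) =
          (T \ slotsIn A) ∩ slotsIn B := by
        intro T; ext e; simp only [Finset.mem_inter, Finset.mem_sdiff]; tauto
      have hfactor := expect_inter_mul_sdiff (slotsIn A)
        (fun S => if S.card = i then (1 : ℝ) else 0)
        (fun S => if (S ∩ slotsIn B).card ≤ i then (1 : ℝ) else 0)
      have ho := hout A hA B (hNI A B hB)
      simp only [hfac] at ho ⊢
      rw [hfactor, hprob A hA]
      exact mul_le_mul_of_nonneg_left ho hp0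
    rw [← Finset.mul_sum, hprob A hA, ← Finset.add_sum_erase _ _ (hself A hA), hprob A hA]
    nlinarith
  have hZ : expZ n K i = I.card * p := by
    rw [expZ, hI, Finset.card_powersetCard, Finset.card_univ, Fintype.card_fin, mul_div_assoc]
  have := Finset.sum_le_sum hterm
  rw [Finset.sum_const, nsmul_eq_mul] at this
  rw [hZ]
  calc _ ≤ 2 * (I.card * (p * (p + 2 * S))) := mul_le_mul_of_nonneg_left this (by norm_num)
    _ = _ := by ring
lemma choose_sub_mul_pow_le {n K : ℕ} (h : 2 * K ≤ n) (s : ℕ) (hs : s ≤ K) :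
    n.choose (K - s) * n ^ s ≤ n.choose K * (2 * K) ^ s := by
  induction s with
  | zero => simp
  | succ s ih =>
    have ih := ih (by omega)
    obtain ⟨m, hm⟩ : ∃ m, K - s = m + 1 := ⟨K - s - 1, by omega⟩
    have hm' : K - (s + 1) = m := by omega
    rw [hm] at ih
    rw [hm', pow_succ, pow_succ]
    have h1 := Nat.choose_succ_right_eq n m
    have h2 : n ≤ 2 * (n - m) := by omega
    calc n.choose m * (n ^ s * n) ≤ n.choose m * (n ^ s * (2 * (n - m))) := by gcongr
      _ = (n.choose m * (n - m)) * (2 * n ^ s) := by ring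
      _ = (n.choose (m + 1) * n ^ s) * (2 * (m + 1)) := by rw [← h1]; ring
      _ ≤ (n.choose K * (2 * K) ^ s) * (2 * K) := by gcongr; omega
      _ = _ := by ring

lemma two_pow_choose_two (s : ℕ) :
    (2 : ℝ) ^ (s.choose 2) = ((2 : ℝ) ^ (((s : ℝ) - 1) / 2)) ^ s := by
  rw [← Real.rpow_natCast, ← Real.rpow_natCast, ← Real.rpow_mul (by norm_num),
    Nat.cast_choose_two]
  congr 1; ring

lemma two_pow_choose_two_sub {s K : ℕ} (h : s ≤ K) :
    (2 : ℝ) ^ (K.choose 2 - s.choose 2) =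
      ((2 : ℝ) ^ (((K : ℝ) + s - 1) / 2)) ^ (K - s) := by
  rw [← Real.rpow_natCast, ← Real.rpow_natCast, ← Real.rpow_mul (by norm_num),
    Nat.cast_sub (Nat.choose_le_choose 2 h), Nat.cast_choose_two, Nat.cast_choose_two,
    Nat.cast_sub h]
  congr 1; ring

lemma overlap_term_le_of_small {n K i s : ℕ} {M lam : ℝ} (hn : 1 ≤ n) (h2 : 2 * K ≤ n)
    (hlam : (n.choose K : ℝ) / 2 ^ (K.choose 2) ≤ lam) (hM : ((K : ℝ) ^ 2) ^ i ≤ M)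
    (hs2 : 2 ≤ s) (hs : (s : ℝ) ≤ 9 / 16 * K)
    (hx : 2 * (K : ℝ) ^ 2 * ((2 : ℝ) ^ K) ^ (9 / 32 : ℝ) / n ≤ 1) :
    (K.choose s * n.choose (K - s) : ℝ) *
        (((K : ℝ) ^ 2) ^ i / 2 ^ (K.choose 2 - s.choose 2)) ≤
      M * lam * (2 * (K : ℝ) ^ 2 * ((2 : ℝ) ^ K) ^ (9 / 32 : ℝ) / n) ^ 2 := by
  have hsK : s ≤ K := by
    have : (s : ℝ) ≤ K := hs.trans (by linarith [(K.cast_nonneg : (0 : ℝ) ≤ K)])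
    exact_mod_cast this
  set x : ℝ := 2 * (K : ℝ) ^ 2 * ((2 : ℝ) ^ K) ^ (9 / 32 : ℝ) / n with hxdef
  have hx0 : 0 ≤ x := by positivity
  have hn0 : (0 : ℝ) < n := by exact_mod_cast hn
  have hlam0 : 0 ≤ lam := le_trans (by positivity) hlam
  have hM0 : 0 ≤ M := le_trans (by positivity) hM
  have c1 : (K.choose s : ℝ) ≤ (K : ℝ) ^ s := by exact_mod_cast Nat.choose_le_pow _ _
  have c2 : (n.choose (K - s) : ℝ) ≤ n.choose K * (2 * K / n) ^ s := by
    rw [div_pow, mul_div_assoc', le_div_iff₀ (by positivity)]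
    exact_mod_cast choose_sub_mul_pow_le h2 s hsK
  have c3 : (2 : ℝ) ^ (((s : ℝ) - 1) / 2) ≤ ((2 : ℝ) ^ K) ^ (9 / 32 : ℝ) := by
    rw [← Real.rpow_natCast, ← Real.rpow_mul (by norm_num)]
    exact Real.rpow_le_rpow_of_exponent_le (by norm_num) (by linarith)
  have c4 : (2 : ℝ) ^ (K.choose 2 - s.choose 2) =
      2 ^ (K.choose 2) / ((2 : ℝ) ^ (((s : ℝ) - 1) / 2)) ^ s := by
    rw [← two_pow_choose_two, eq_div_iff (by positivity), ← pow_add,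
      Nat.sub_add_cancel (Nat.choose_le_choose 2 hsK)]
  rw [c4]
  calc _ ≤ ((K : ℝ) ^ s * (n.choose K * (2 * K / n) ^ s)) *
        (M / (2 ^ (K.choose 2) / (((2 : ℝ) ^ K) ^ (9 / 32 : ℝ)) ^ s)) := by gcongr
    _ = M * ((n.choose K : ℝ) / 2 ^ (K.choose 2)) * x ^ s := by
      have : x ^ s = (K : ℝ) ^ s * (2 * K / n) ^ s * (((2 : ℝ) ^ K) ^ (9 / 32 : ℝ)) ^ s := by
        rw [← mul_pow, ← mul_pow, hxdef]
        congr 1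
        ring
      rw [this]
      field_simp
    _ ≤ M * lam * x ^ 2 := by
      exact mul_le_mul (mul_le_mul_of_nonneg_left hlam hM0) (pow_le_pow_of_le_one hx0 hx hs2)
        (by positivity) (by positivity)

lemma overlap_term_le_of_large {n K i s : ℕ} {M : ℝ} (hM : ((K : ℝ) ^ 2) ^ i ≤ M)
    (hs : 9 / 16 * (K : ℝ) ≤ s) (hsK : s < K)
    (hy : (K : ℝ) * n * (2 / ((2 : ℝ) ^ K) ^ (25 / 32 : ℝ)) ≤ 1) :
    (K.choose s * n.choose (K - s) : ℝ) *
        (((K : ℝ) ^ 2) ^ i / 2 ^ (K.choose 2 - s.choose 2)) ≤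
      M * (K * n * (2 / ((2 : ℝ) ^ K) ^ (25 / 32 : ℝ))) := by
  have hM0 : 0 ≤ M := le_trans (by positivity) hM
  set y : ℝ := K * n * (2 / ((2 : ℝ) ^ K) ^ (25 / 32 : ℝ)) with hydef
  have hy0 : 0 ≤ y := by positivity
  have c1 : (K.choose s : ℝ) ≤ (K : ℝ) ^ (K - s) := by
    rw [← Nat.choose_symm hsK.le]
    exact_mod_cast Nat.choose_le_pow _ _
  have c2 : (n.choose (K - s) : ℝ) ≤ (n : ℝ) ^ (K - s) := by
    exact_mod_cast Nat.choose_le_pow _ _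
  have c3 : ((2 : ℝ) ^ K) ^ (25 / 32 : ℝ) / 2 ≤ (2 : ℝ) ^ (((K : ℝ) + s - 1) / 2) := by
    rw [← Real.rpow_natCast, ← Real.rpow_mul (by norm_num)]
    nth_rewrite 2 [← Real.rpow_one 2]
    rw [← Real.rpow_sub (by norm_num)]
    exact Real.rpow_le_rpow_of_exponent_le (by norm_num) (by linarith)
  rw [two_pow_choose_two_sub hsK.le]
  calc _ ≤ ((K : ℝ) ^ (K - s) * (n : ℝ) ^ (K - s)) *
        (M / (((2 : ℝ) ^ K) ^ (25 / 32 : ℝ) / 2) ^ (K - s)) := by gcongr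
    _ = M * y ^ (K - s) := by
      have : y ^ (K - s) = (K : ℝ) ^ (K - s) * (n : ℝ) ^ (K - s) /
          (((2 : ℝ) ^ K) ^ (25 / 32 : ℝ) / 2) ^ (K - s) := by
        rw [← mul_pow, ← div_pow, hydef]
        congr 1
        field_simp
      rw [this]
      ring
    _ ≤ M * y := by
      gcongr
      exact pow_le_of_le_one hy0 hy (by omega)

/-- The error term of the Poisson approximation is at most `n^{-1/4}` in the relevant range. -/
lemma poisson_error_le {n K i : ℕ} (hn : 1 ≤ n) (hK : 2 ≤ K) (h2K : 2 * K ≤ n)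
    (hi : i ≤ K.choose 2)
    (h2 : (2 : ℝ) ≤ (n : ℝ) ^ (1 / 128 : ℝ)) (hKn : (K : ℝ) ≤ (n : ℝ) ^ (1 / 128 : ℝ))
    (hKi : ((K : ℝ) ^ 2) ^ i ≤ (n : ℝ) ^ (1 / 128 : ℝ))
    (hup : (2 : ℝ) ^ K ≤ (n : ℝ) ^ (2 + 1 / 128 : ℝ))
    (hlo : (n : ℝ) ^ (2 - 1 / 128 : ℝ) ≤ (2 : ℝ) ^ K)
    (hlam : expZ n K i ≤ (n : ℝ) ^ (1 / 4 : ℝ)) :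
    2 * expZ n K i * (((K.choose 2).choose i : ℝ) / 2 ^ (K.choose 2) +
        2 * ∑ s ∈ Finset.Ico 2 K, (K.choose s * n.choose (K - s) : ℝ) *
          (((K : ℝ) ^ 2) ^ i / 2 ^ (K.choose 2 - s.choose 2))) ≤
      (n : ℝ) ^ (-(1 / 4) : ℝ) := by
  have hn1 : (1 : ℝ) ≤ n := by exact_mod_cast hn
  have hn0 : (0 : ℝ) < n := by linarith
  have hmono : ∀ {a b : ℝ}, a ≤ b → (n : ℝ) ^ a ≤ (n : ℝ) ^ b := fun h =>
    Real.rpow_le_rpow_of_exponent_le hn1 h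
  have hle1 : ∀ {a : ℝ}, a ≤ 0 → (n : ℝ) ^ a ≤ 1 := fun h => Real.rpow_le_one_of_one_le_of_nonpos hn1 h
  have hmul : ∀ a b : ℝ, (n : ℝ) ^ a * (n : ℝ) ^ b = (n : ℝ) ^ (a + b) := fun a b =>
    (Real.rpow_add hn0 a b).symm
  have hpow : ∀ (a : ℝ) (m : ℕ), ((n : ℝ) ^ a) ^ m = (n : ℝ) ^ (a * m) := fun a m =>
    (Real.rpow_mul_natCast hn0.le a m).symm
  have hx : 2 * (K : ℝ) ^ 2 * ((2 : ℝ) ^ K) ^ (9 / 32 : ℝ) / n ≤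
      (n : ℝ) ^ (-(7 / 16) + 4 / 128 : ℝ) := by
    have h1 : ((2 : ℝ) ^ K) ^ (9 / 32 : ℝ) ≤ (n : ℝ) ^ ((2 + 1 / 128) * (9 / 32) : ℝ) := by
      rw [Real.rpow_mul hn0.le]
      exact Real.rpow_le_rpow (by positivity) hup (by norm_num)
    rw [div_le_iff₀ hn0]
    calc _ ≤ (n : ℝ) ^ (1 / 128 : ℝ) * ((n : ℝ) ^ (1 / 128 : ℝ)) ^ 2 *
          (n : ℝ) ^ ((2 + 1 / 128) * (9 / 32) : ℝ) := by gcongr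
      _ ≤ (n : ℝ) ^ (-(7 / 16) + 4 / 128 : ℝ) * (n : ℝ) ^ (1 : ℝ) := by
        rw [hpow, hmul, hmul, hmul]
        exact hmono (by norm_num)
      _ = _ := by rw [Real.rpow_one]
  have hy : (K : ℝ) * n * (2 / ((2 : ℝ) ^ K) ^ (25 / 32 : ℝ)) ≤
      (n : ℝ) ^ (-(9 / 16) + 3 / 128 : ℝ) := by
    have h1 : (n : ℝ) ^ ((2 - 1 / 128) * (25 / 32) : ℝ) ≤ ((2 : ℝ) ^ K) ^ (25 / 32 : ℝ) := by
      rw [Real.rpow_mul hn0.le]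
      exact Real.rpow_le_rpow (by positivity) hlo (by norm_num)
    calc _ ≤ (n : ℝ) ^ (1 / 128 : ℝ) * (n : ℝ) ^ (1 : ℝ) *
          ((n : ℝ) ^ (1 / 128 : ℝ) / (n : ℝ) ^ ((2 - 1 / 128) * (25 / 32) : ℝ)) := by
          rw [Real.rpow_one]; gcongr
      _ ≤ _ := by
        rw [← Real.rpow_sub hn0, hmul, hmul]
        exact hmono (by norm_num)
  have hcr : (n.choose K : ℝ) / 2 ^ (K.choose 2) ≤ expZ n K i := by
    have : (1 : ℝ) ≤ (K.choose 2).choose i := by exact_mod_cast Nat.choose_pos hi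
    unfold expZ
    gcongr
    exact le_mul_of_one_le_right (by positivity) this
  have hZ0 : 0 ≤ expZ n K i := le_trans (by positivity) hcr
  have hterm : ∀ s ∈ Finset.Ico 2 K, (K.choose s * n.choose (K - s) : ℝ) *
      (((K : ℝ) ^ 2) ^ i / 2 ^ (K.choose 2 - s.choose 2)) ≤
        (n : ℝ) ^ (-(9 / 16) + 4 / 128 : ℝ) := by
    intro s hs
    obtain ⟨hs2, hsK⟩ := Finset.mem_Ico.1 hs
    rcases le_total (s : ℝ) (9 / 16 * K) with h | h
    · refine (overlap_term_le_of_small hn h2K (hcr.trans hlam) hKi hs2 h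
        (hx.trans (hle1 (by norm_num)))).trans ?_
      calc _ ≤ (n : ℝ) ^ (1 / 128 : ℝ) * (n : ℝ) ^ (1 / 4 : ℝ) *
            ((n : ℝ) ^ (-(7 / 16) + 4 / 128 : ℝ)) ^ 2 := by gcongr
        _ ≤ _ := by
          rw [hpow, hmul, hmul]
          exact hmono (by norm_num)
    · refine (overlap_term_le_of_large hKi h hsK (hy.trans (hle1 (by norm_num)))).trans ?_
      calc _ ≤ (n : ℝ) ^ (1 / 128 : ℝ) * (n : ℝ) ^ (-(9 / 16) + 3 / 128 : ℝ) := by gcongr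
        _ ≤ _ := by
          rw [hmul]
          exact hmono (by norm_num)
  have hsum : ∑ s ∈ Finset.Ico 2 K, (K.choose s * n.choose (K - s) : ℝ) *
      (((K : ℝ) ^ 2) ^ i / 2 ^ (K.choose 2 - s.choose 2)) ≤
        (n : ℝ) ^ (-(9 / 16) + 5 / 128 : ℝ) := by
    refine (Finset.sum_le_sum hterm).trans ?_
    rw [Finset.sum_const, nsmul_eq_mul, Nat.card_Ico]
    calc _ ≤ (n : ℝ) ^ (1 / 128 : ℝ) * (n : ℝ) ^ (-(9 / 16) + 4 / 128 : ℝ) := by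
          gcongr
          refine le_trans ?_ hKn
          exact_mod_cast Nat.sub_le _ _
      _ ≤ _ := by
        rw [hmul]
        exact hmono (by norm_num)
  have hp : ((K.choose 2).choose i : ℝ) / 2 ^ (K.choose 2) ≤
      (n : ℝ) ^ (-(9 / 16) + 5 / 128 : ℝ) := by
    have hcn : (n : ℝ) ≤ n.choose K := by
      have h := choose_sub_mul_pow_le h2K (K - 1) (by omega)
      rw [Nat.sub_sub_self (by omega), Nat.choose_one_right] at h
      have h1 : n * n ^ (K - 1) ≤ n.choose K * n ^ (K - 1) :=
        h.trans (Nat.mul_le_mul_left _ (Nat.pow_le_pow_left h2K _))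
      exact_mod_cast Nat.le_of_mul_le_mul_right h1 (by positivity)
    have h1 : (n : ℝ) * (((K.choose 2).choose i : ℝ) / 2 ^ (K.choose 2)) ≤
        (n : ℝ) ^ (1 / 4 : ℝ) := by
      refine le_trans ?_ hlam
      rw [expZ, mul_div_assoc]
      gcongr
    calc _ ≤ (n : ℝ) ^ (1 / 4 : ℝ) / (n : ℝ) ^ (1 : ℝ) := by
          rw [Real.rpow_one, le_div_iff₀ hn0]; linarith
      _ ≤ _ := by
        rw [← Real.rpow_sub hn0]
        exact hmono (by norm_num)
  set q : ℝ := (n : ℝ) ^ (-(9 / 16) + 5 / 128 : ℝ) with hq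
  have hq0 : 0 ≤ q := by positivity
  calc _ ≤ 2 * (n : ℝ) ^ (1 / 4 : ℝ) * (q + 2 * q) := by gcongr
    _ ≤ 2 ^ 3 * (n : ℝ) ^ (1 / 4 : ℝ) * q := by
      have : 0 ≤ (n : ℝ) ^ (1 / 4 : ℝ) * q := by positivity
      linarith
    _ ≤ ((n : ℝ) ^ (1 / 128 : ℝ)) ^ 3 * (n : ℝ) ^ (1 / 4 : ℝ) * q := by gcongr
    _ ≤ _ := by
      rw [hq, hpow, hmul, hmul]
      exact hmono (by norm_num)
lemma eventually_growth_bounds {C : ℝ} (hC : 0 < C) : ∀ᶠ y : ℝ in Filter.atTop,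
    4 ≤ y ∧ Real.exp 1 ≤ Real.log y ∧ Real.log (C + 5) ≤ Real.log y ∧
      4 * Real.log y ^ 2 ≤ 1 / 128 * y ∧ C * Real.log y + 1 ≤ 1 / 128 * y ∧
      (C + 5) * y ≤ Real.exp (1 / 128 * y) ∧ 2 ≤ Real.exp (1 / 128 * y) := by
  have hlog := Real.tendsto_log_atTop
  have hlin : Filter.Tendsto (fun y : ℝ => 1 / 128 * y) Filter.atTop Filter.atTop :=
    Filter.tendsto_id.const_mul_atTop (by norm_num)
  have h2 : ∀ᶠ y : ℝ in Filter.atTop, Real.log y ^ 2 ≤ 1 / 512 * y := by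
    filter_upwards [(Real.isLittleO_pow_log_id_atTop (n := 2)).bound (c := 1 / 512) (by norm_num),
      Filter.eventually_ge_atTop 0] with y hy h0
    simpa [abs_of_nonneg h0] using hy
  have h3 : ∀ᶠ y : ℝ in Filter.atTop, C * Real.log y ≤ 1 / 256 * y := by
    filter_upwards [Real.isLittleO_log_id_atTop.bound (c := 1 / 256 / C) (by positivity),
      Filter.eventually_ge_atTop 0] with y hy h0
    simp only [id, Real.norm_eq_abs, abs_of_nonneg h0] at hy
    have := mul_le_mul_of_nonneg_left ((le_abs_self _).trans hy) hC.le
    calc _ ≤ _ := this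
      _ = _ := by field_simp
  have h4 : ∀ᶠ y : ℝ in Filter.atTop, (C + 5) * y ≤ Real.exp (1 / 128 * y) := by
    have := (isLittleO_pow_exp_pos_mul_atTop (k := 1) (b := 1 / 128) (by norm_num)).bound
      (c := 1 / (C + 5)) (by positivity)
    filter_upwards [this, Filter.eventually_ge_atTop 0] with y hy h0
    simp only [pow_one, Real.norm_eq_abs, abs_of_nonneg h0, Real.abs_exp] at hy
    have := mul_le_mul_of_nonneg_left hy (by positivity : 0 ≤ C + 5)
    calc _ ≤ _ := this
      _ = _ := by field_simp
  filter_upwards [Filter.eventually_ge_atTop 4, hlog.eventually_ge_atTop (Real.exp 1),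
    hlog.eventually_ge_atTop (Real.log (C + 5)), h2, h3, h4, hlin.eventually_ge_atTop 2]
    with y a1 a2 a3 a4 a5 a6 a7
  refine ⟨a1, a2, a3, by linarith, by linarith, a6, ?_⟩
  linarith [Real.add_one_le_exp (1 / 128 * y)]

theorem stmt1 (C : ℝ) (hC : 0 < C) :
    ∃ ε₀ : ℝ, 0 < ε₀ ∧ ∃ N : ℕ, ∀ n : ℕ, N ≤ n → ∀ k r j : ℕ,
      |(k : ℝ) - 2 * Real.logb 2 n| ≤ C * Real.log (Real.log n) →
      1 ≤ r →
      (r : ℝ) ≤ ε₀ * Real.log (Real.log n) / Real.log (Real.log (Real.log n)) →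
      1 ≤ j → j ≤ r →
      expZ n (k + 1) (muD r j) ≤ (n : ℝ) ^ (1 / 4 : ℝ) →
      |poissonTail (expZ n (k + 1) (muD r j)) (xiD r j) -
          grPr n {G | xiD r j ≤ numZ n (k + 1) (muD r j) G}| ≤
        (n : ℝ) ^ (-(1 / 4) : ℝ) := by

  refine ⟨1, one_pos, ?_⟩
  have hev := (Real.tendsto_log_atTop.comp tendsto_natCast_atTop_atTop).eventually
    (eventually_growth_bounds hC)
  obtain ⟨N, hN⟩ := Filter.eventually_atTop.1 hev
  refine ⟨max N 1, fun n hn k r j hk _ hr _ _ hlam => ?_⟩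
  have hn1 : 1 ≤ n := (le_max_right _ _).trans hn
  have hn0 : (0 : ℝ) < n := by exact_mod_cast hn1
  obtain ⟨g1, g2, g3, g4, g5, g6, g7⟩ := hN n ((le_max_left _ _).trans hn)
  simp only [Function.comp] at g1 g2 g3 g4 g5 g6 g7
  set y := Real.log n with hy
  set z := Real.log y with hz
  have hrpow : ∀ a : ℝ, (n : ℝ) ^ a = Real.exp (a * y) := fun a => by
    rw [Real.rpow_def_of_pos hn0, mul_comm]
  have hz0 : 0 < z := (Real.exp_pos 1).trans_le g2
  have hz1 : 1 ≤ Real.log z := (Real.le_log_iff_exp_le hz0).2 g2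
  have hzy : z ≤ y := Real.log_le_self (by linarith)
  set i := muD r j with hi
  have hir : (i : ℝ) ≤ z := by
    have h1 : (i : ℝ) ≤ r := by
      exact_mod_cast (Nat.div_le_self _ _).trans (Nat.sub_le _ _)
    refine h1.trans (hr.trans ?_)
    rw [one_mul]
    exact div_le_self hz0.le hz1
  have hl2a : (0.6931471803 : ℝ) < Real.log 2 := Real.log_two_gt_d9
  have hl2b : Real.log 2 < (0.6931471808 : ℝ) := Real.log_two_lt_d9
  have hl20 : 0 < Real.log 2 := by linarith
  set b := Real.logb 2 n with hb
  have hby : b * Real.log 2 = y := by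
    rw [hb, Real.logb, div_mul_cancel₀ _ hl20.ne']
  have hb1 : y ≤ b := by nlinarith
  have hb2 : b ≤ 3 / 2 * y := by nlinarith
  obtain ⟨hk1, hk2⟩ := abs_le.1 hk
  set K := k + 1 with hKdef
  have hKc : (K : ℝ) = k + 1 := by rw [hKdef]; push_cast; ring
  have hKlo : (2 - 1 / 128) * b ≤ K := by rw [hKc]; linarith
  have hKup : (K : ℝ) ≤ (2 + 1 / 128) * b := by rw [hKc]; linarith
  have hKy : y ≤ K := by linarith
  have hK4 : 4 ≤ K := by exact_mod_cast g1.trans hKy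
  have hKC : (K : ℝ) ≤ (C + 5) * y := by
    have : 0 < C * y := by nlinarith
    nlinarith
  have h2pow : (2 : ℝ) ^ K = Real.exp (K * Real.log 2) := by
    rw [Real.exp_nat_mul, Real.exp_log two_pos]
  have e1 : (K : ℝ) ≤ (n : ℝ) ^ (1 / 128 : ℝ) := by
    rw [hrpow]; exact hKC.trans g6
  have e2 : (2 : ℝ) ≤ (n : ℝ) ^ (1 / 128 : ℝ) := by
    rw [hrpow]; exact g7
  have e3 : ((K : ℝ) ^ 2) ^ i ≤ (n : ℝ) ^ (1 / 128 : ℝ) := by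
    have hK0 : (0 : ℝ) < K := by linarith
    have hlK : Real.log K ≤ 2 * z := by
      refine (Real.log_le_log hK0 hKC).trans ?_
      rw [Real.log_mul (by positivity) (by linarith)]
      linarith
    rw [hrpow, ← Real.log_le_iff_le_exp (by positivity), Real.log_pow, Real.log_pow]
    push_cast
    calc (i : ℝ) * (2 * Real.log K) ≤ z * (2 * (2 * z)) := by gcongr
      _ ≤ _ := by linarith
  have e4 : (2 : ℝ) ^ K ≤ (n : ℝ) ^ (2 + 1 / 128 : ℝ) := by
    rw [hrpow, h2pow, ← hby, ← mul_assoc]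
    exact Real.exp_le_exp.2 (mul_le_mul_of_nonneg_right hKup hl20.le)
  have e5 : (n : ℝ) ^ (2 - 1 / 128 : ℝ) ≤ (2 : ℝ) ^ K := by
    rw [hrpow, h2pow, ← hby, ← mul_assoc]
    exact Real.exp_le_exp.2 (mul_le_mul_of_nonneg_right hKlo hl20.le)
  have e6 : 2 * K ≤ n := by
    have : (2 : ℝ) * K ≤ n := by
      calc (2 : ℝ) * K ≤ (n : ℝ) ^ (1 / 128 : ℝ) * (n : ℝ) ^ (1 / 128 : ℝ) := by gcongr
        _ ≤ (n : ℝ) ^ (1 : ℝ) := by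
          rw [← Real.rpow_add hn0]
          exact Real.rpow_le_rpow_of_exponent_le (by exact_mod_cast hn1) (by norm_num)
        _ = n := Real.rpow_one _
    exact_mod_cast this
  have e7 : i ≤ K.choose 2 := by
    have h1 : i ≤ K := by exact_mod_cast hir.trans (hzy.trans hKy)
    refine h1.trans ?_
    rw [Nat.choose_two_right, Nat.le_div_iff_mul_le two_pos]
    exact Nat.mul_le_mul_left _ (by omega)
  have hpos : 0 < expZ n K i := by
    have h1 : 0 < n.choose K := Nat.choose_pos (by omega)
    have h2 : 0 < (K.choose 2).choose i := Nat.choose_pos e7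
    unfold expZ
    positivity
  exact (abs_poissonTail_sub_grPr_le (by omega) hpos _).trans
    (poisson_error_le hn1 (by omega) e6 e7 e2 e1 e3 e4 e5 hlam)
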